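/- Let p be an odd prime and k a field of characteristic p. Let G be the elementary abelian group (ℤ/pℤ) × (ℤ/pℤ), written multiplicatively with generators x and y, and let kG be its group algebra. Let M = kG/I, where I is the ideal of kG generated by (y−1)² and (x−1)(y−1), regarded as a representation of G over k via the quotient kG-module structure, and let M* = Hom_k(M, k) be the contragredient (k-linear dual) representation. Then for every natural number n, the group cohomology H^n(G, M*) is a k-vector space of dimension n + 1. -/

import Mathlib

/-- The elementary abelian group `G = (ℤ/pℤ) × (ℤ/pℤ)`, written multiplicatively. -/
abbrev ElemAbelian (p : ℕ) : Type := Multiplicative (ZMod p × ZMod p)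

/-- The generator `x` of `G`, viewed in the group algebra `kG`. -/
noncomputable def xGen (p : ℕ) (k : Type) [Field k] : MonoidAlgebra k (ElemAbelian p) :=
  MonoidAlgebra.of k (ElemAbelian p) (Multiplicative.ofAdd ((1 : ZMod p), (0 : ZMod p)))

/-- The generator `y` of `G`, viewed in the group algebra `kG`. -/
noncomputable def yGen (p : ℕ) (k : Type) [Field k] : MonoidAlgebra k (ElemAbelian p) :=
  MonoidAlgebra.of k (ElemAbelian p) (Multiplicative.ofAdd ((0 : ZMod p), (1 : ZMod p)))

/-- The ideal `I = ((y-1)², (x-1)(y-1))` of `kG`. -/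
noncomputable def genIdeal (p : ℕ) (k : Type) [Field k] :
    Ideal (MonoidAlgebra k (ElemAbelian p)) :=
  Ideal.span {(yGen p k - 1) ^ 2, (xGen p k - 1) * (yGen p k - 1)}

/-- The `kG`-module `M = kG/I`. -/
abbrev genModule (p : ℕ) (k : Type) [Field k] : Type :=
  MonoidAlgebra k (ElemAbelian p) ⧸ genIdeal p k


namespace GenDual

open Finset

/-- `of (e,0) - 1`. -/
noncomputable def xE (p : ℕ) (k : Type) [Field k] (e : ZMod p) : MonoidAlgebra k (ElemAbelian p) :=
  MonoidAlgebra.of k (ElemAbelian p) (Multiplicative.ofAdd (e, (0 : ZMod p))) - 1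

/-- `of (0,e) - 1`. -/
noncomputable def yE (p : ℕ) (k : Type) [Field k] (e : ZMod p) : MonoidAlgebra k (ElemAbelian p) :=
  MonoidAlgebra.of k (ElemAbelian p) (Multiplicative.ofAdd ((0 : ZMod p), e)) - 1

/-- Coefficient functionals for the monomial basis `X^i Y^j`. -/
structure Coords {k R : Type} [Field k] [CommRing R] [Algebra k R] (p : ℕ) (X Y : R) where
  c : ℕ → ℕ → R →ₗ[k] k
  Xp : X ^ p = 0
  Yp : Y ^ p = 0
  expand : ∀ r : R, r = ∑ i ∈ range p, ∑ j ∈ range p, c i j r • (X ^ i * Y ^ j)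
  c_mon : ∀ i j i' j', i < p → j < p → i' < p → j' < p →
    c i j (X ^ i' * Y ^ j') = if i = i' ∧ j = j' then 1 else 0

section basis
variable (p : ℕ) [Fact p.Prime] (k : Type) [Field k] [CharP k p] (e : ZMod p)

lemma xE_pow : xE p k e ^ p = 0 := by
  have : CharP (MonoidAlgebra k (ElemAbelian p)) p := charP_of_injective_algebraMap
    (FaithfulSMul.algebraMap_injective k _) p
  rw [xE, sub_pow_char, ← map_pow, ← ofAdd_nsmul]
  simp only [Prod.smul_mk, nsmul_eq_mul, CharP.cast_eq_zero, zero_mul, mul_zero]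
  rw [one_pow, show Multiplicative.ofAdd ((0 : ZMod p), (0 : ZMod p)) = 1 from rfl, map_one,
    sub_self]

lemma yE_pow : yE p k e ^ p = 0 := by
  have : CharP (MonoidAlgebra k (ElemAbelian p)) p := charP_of_injective_algebraMap
    (FaithfulSMul.algebraMap_injective k _) p
  rw [yE, sub_pow_char, ← map_pow, ← ofAdd_nsmul]
  simp only [Prod.smul_mk, nsmul_eq_mul, CharP.cast_eq_zero, zero_mul, mul_zero]
  rw [one_pow, show Multiplicative.ofAdd ((0 : ZMod p), (0 : ZMod p)) = 1 from rfl, map_one,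
    sub_self]

lemma span_mon (he : e ≠ 0) :
    (⊤ : Submodule k (MonoidAlgebra k (ElemAbelian p))) ≤ Submodule.span k
      (Set.range (fun q : Fin p × Fin p => xE p k e ^ (q.1 : ℕ) * yE p k e ^ (q.2 : ℕ))) := by
  set S := Submodule.span k
      (Set.range (fun q : Fin p × Fin p => xE p k e ^ (q.1 : ℕ) * yE p k e ^ (q.2 : ℕ))) with hS
  have hm : ∀ i j : ℕ, xE p k e ^ i * yE p k e ^ j ∈ S := by
    intro i j
    by_cases hi : i < p
    · by_cases hj : j < p
      · exact Submodule.subset_span ⟨(⟨i, hi⟩, ⟨j, hj⟩), rfl⟩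
      · rw [pow_eq_zero_of_le (not_lt.1 hj) (yE_pow p k e), mul_zero]; exact S.zero_mem
    · rw [pow_eq_zero_of_le (not_lt.1 hi) (xE_pow p k e), zero_mul]; exact S.zero_mem
  intro r _
  induction r using MonoidAlgebra.induction_on with
  | of g =>
    obtain ⟨a, b⟩ := g
    have : MonoidAlgebra.of k (ElemAbelian p) (Multiplicative.ofAdd (a, b)) =
        (xE p k e + 1) ^ (a / e).val * (yE p k e + 1) ^ (b / e).val := by
      rw [xE, yE, sub_add_cancel, sub_add_cancel, ← map_pow (MonoidAlgebra.of k (ElemAbelian p)),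
        ← map_pow (MonoidAlgebra.of k (ElemAbelian p)), ← map_mul (MonoidAlgebra.of k (ElemAbelian p)),
        ← ofAdd_nsmul, ← ofAdd_nsmul, ← ofAdd_add]
      congr 2
      ext <;> simp [he]
    change MonoidAlgebra.of k (ElemAbelian p) (Multiplicative.ofAdd (a, b)) ∈ S
    rw [this, add_pow, add_pow, sum_mul_sum]
    refine S.sum_mem fun i _ => S.sum_mem fun j _ => ?_
    have := S.smul_mem (((a / e).val.choose i * (b / e).val.choose j : ℕ) : k) (hm i j)
    convert this using 1
    rw [Algebra.smul_def]
    simp only [one_pow, mul_one, map_natCast]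
    push_cast
    ring
  | add f g hf hg => exact S.add_mem (hf trivial) (hg trivial)
  | smul c f hf => exact S.smul_mem c (hf trivial)

/-- The monomial coordinates on `kG`. -/
noncomputable def coords (he : e ≠ 0) : Coords (k := k) p (xE p k e) (yE p k e) := by
  let b : Module.Basis (Fin p × Fin p) k (MonoidAlgebra k (ElemAbelian p)) :=
    basisOfTopLeSpanOfCardEqFinrank _ (span_mon p k e he) (by
      rw [(MonoidAlgebra.coeffLinearEquiv k).finrank_eq, Module.finrank_finsupp_self]
      simp [ZMod.card])
  have hb : ∀ q, b q = xE p k e ^ (q.1 : ℕ) * yE p k e ^ (q.2 : ℕ) := fun q => by simp [b]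
  refine ⟨fun i j => if h : i < p ∧ j < p then b.coord (⟨i, h.1⟩, ⟨j, h.2⟩) else 0,
    xE_pow p k e, yE_pow p k e, ?_, ?_⟩
  · intro r
    conv_lhs => rw [← b.sum_repr r]
    rw [Fintype.sum_prod_type, ← Fin.sum_univ_eq_sum_range]
    refine sum_congr rfl fun i _ => ?_
    rw [← Fin.sum_univ_eq_sum_range]
    refine sum_congr rfl fun j _ => ?_
    rw [dif_pos ⟨i.2, j.2⟩, hb]
    rfl
  · intro i j i' j' hi hj hi' hj'
    simp only [hi, hj, and_self, dif_pos]
    have := hb (⟨i', hi'⟩, ⟨j', hj'⟩)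
    simp only at this
    rw [← this, Module.Basis.coord_apply, Module.Basis.repr_self, Finsupp.single_apply]
    simp only [Prod.mk.injEq, Fin.mk.injEq]
    congr 1
    simp only [eq_comm]

end basis

namespace Coords
variable {k R : Type} [Field k] [CommRing R] [Algebra k R] {p : ℕ} {X Y : R}

lemma ext_lin (C : Coords (k := k) p X Y)
    {f g : R →ₗ[k] k} (h : ∀ i j, i < p → j < p → f (X ^ i * Y ^ j) = g (X ^ i * Y ^ j)) :
    f = g := by
  ext r
  rw [C.expand r]
  simp only [map_sum, map_smul]
  refine sum_congr rfl fun i hi => sum_congr rfl fun j hj => ?_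
  rw [h i j (mem_range.1 hi) (mem_range.1 hj)]

lemma c_X_succ (C : Coords (k := k) p X Y)
    (i j : ℕ) (hi : i + 1 < p) (hj : j < p) (r : R) :
    C.c (i + 1) j (X * r) = C.c i j r := by
  refine LinearMap.congr_fun (f := C.c (i+1) j ∘ₗ LinearMap.mulLeft k X) (C.ext_lin ?_) r
  intro i' j' hi' hj'
  simp only [LinearMap.comp_apply, LinearMap.mulLeft_apply, ← mul_assoc, ← pow_succ']
  rw [C.c_mon i j i' j' (by omega) hj hi' hj']
  by_cases h : i' + 1 < p
  · rw [C.c_mon _ _ _ _ hi hj h hj']; simp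
  · rw [pow_eq_zero_of_le (not_lt.1 h) C.Xp, zero_mul, map_zero, if_neg (by omega)]

lemma c_X_zero (C : Coords (k := k) p X Y)
    (j : ℕ) (hj : j < p) (r : R) : C.c 0 j (X * r) = 0 := by
  refine LinearMap.congr_fun (f := C.c 0 j ∘ₗ LinearMap.mulLeft k X) (g := 0) (C.ext_lin ?_) r
  intro i' j' hi' hj'
  simp only [LinearMap.comp_apply, LinearMap.mulLeft_apply, ← mul_assoc, ← pow_succ']
  by_cases h : i' + 1 < p
  · rw [C.c_mon _ _ _ _ (by omega) hj h hj']; simp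
  · rw [pow_eq_zero_of_le (not_lt.1 h) C.Xp, zero_mul, map_zero]; simp

lemma c_Y_succ (C : Coords (k := k) p X Y)
    (i j : ℕ) (hi : i < p) (hj : j + 1 < p) (r : R) :
    C.c i (j + 1) (Y * r) = C.c i j r := by
  refine LinearMap.congr_fun (f := C.c i (j+1) ∘ₗ LinearMap.mulLeft k Y) (C.ext_lin ?_) r
  intro i' j' hi' hj'
  simp only [LinearMap.comp_apply, LinearMap.mulLeft_apply, mul_left_comm Y, ← pow_succ']
  rw [C.c_mon i j i' j' hi (by omega) hi' hj']
  by_cases h : j' + 1 < p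
  · rw [C.c_mon _ _ _ _ hi hj hi' h]; simp
  · rw [pow_eq_zero_of_le (not_lt.1 h) C.Yp, mul_zero, map_zero, if_neg (by omega)]

lemma c_Y_zero (C : Coords (k := k) p X Y)
    (i : ℕ) (hi : i < p) (r : R) : C.c i 0 (Y * r) = 0 := by
  refine LinearMap.congr_fun (f := C.c i 0 ∘ₗ LinearMap.mulLeft k Y) (g := 0) (C.ext_lin ?_) r
  intro i' j' hi' hj'
  simp only [LinearMap.comp_apply, LinearMap.mulLeft_apply, mul_left_comm Y, ← pow_succ']
  by_cases h : j' + 1 < p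
  · rw [C.c_mon _ _ _ _ hi (by omega) hi' h]; simp
  · rw [pow_eq_zero_of_le (not_lt.1 h) C.Yp, mul_zero, map_zero]; simp

lemma c_Y_pow (C : Coords (k := k) p X Y)
    (i j : ℕ) (hi : i < p) (hj : j < p) (r : R) :
    C.c i j (Y ^ j * r) = C.c i 0 r := by
  induction j with
  | zero => simp
  | succ j ih => rw [pow_succ', mul_assoc, C.c_Y_succ i j hi hj, ih (by omega)]

lemma c_X_pow (C : Coords (k := k) p X Y)
    (i j : ℕ) (hi : i < p) (hj : j < p) (r : R) :
    C.c i j (X ^ i * r) = C.c 0 j r := by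
  induction i with
  | zero => simp
  | succ i ih => rw [pow_succ', mul_assoc, C.c_X_succ i j hi hj, ih (by omega)]

lemma exact_Y (C : Coords (k := k) p X Y)
    (r : R) (h : Y * r = 0) : ∃ t, r = Y ^ (p - 1) * t := by
  change Y ^ (p - 1) ∣ r
  rw [C.expand r]
  refine dvd_sum fun i hi => dvd_sum fun j hj => ?_
  rw [mem_range] at hi hj
  by_cases hj' : j + 1 < p
  · rw [← C.c_Y_succ i j hi hj', h]; simp
  · rw [show j = p - 1 by omega]
    exact (Dvd.intro_left _ rfl).trans (by rw [Algebra.smul_def]; exact Dvd.intro_left _ rfl)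

lemma exact_Y' (C : Coords (k := k) p X Y)
    (hp : 0 < p) (r : R) (h : Y ^ (p - 1) * r = 0) : ∃ t, r = Y * t := by
  change Y ∣ r
  rw [C.expand r]
  refine dvd_sum fun i hi => dvd_sum fun j hj => ?_
  rw [mem_range] at hi hj
  rcases j with _ | j
  · rw [← C.c_Y_pow i (p - 1) hi (by omega), h]; simp
  · rw [Algebra.smul_def, pow_succ']
    exact ⟨algebraMap k R (C.c i (j+1) r) * X ^ i * Y ^ j, by ring⟩

lemma mem_aux (C : Coords (k := k) p X Y)
    (I : Ideal R) (r : R)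
    (h : ∀ i j, i < p → j < p → C.c i j r = 0 ∨ X ^ i * Y ^ j ∈ I) : r ∈ I := by
  rw [C.expand r]
  refine I.sum_mem fun i hi => I.sum_mem fun j hj => ?_
  rw [mem_range] at hi hj
  rcases h i j hi hj with h | h
  · rw [h, zero_smul]; exact I.zero_mem
  · rw [Algebra.smul_def]; exact I.mul_mem_left _ h

lemma Y_mem {R : Type} [CommRing R] {X Y : R} (Z : R) (i j : ℕ) (hj : j ≠ 0) : X ^ i * Y ^ j ∈ Ideal.span {Z, Y} := by
  obtain ⟨j, rfl⟩ := Nat.exists_eq_succ_of_ne_zero hj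
  exact Ideal.mem_span_pair.2 ⟨0, X ^ i * Y ^ j, by rw [pow_succ]; ring⟩

lemma exact_X (C : Coords (k := k) p X Y)
    (r t : R) (h : X * r = Y * t) : ∃ u v, r = X ^ (p - 1) * u + Y * v := by
  have : r ∈ Ideal.span {X ^ (p - 1), Y} := by
    refine C.mem_aux _ r fun i j hi hj => ?_
    rcases eq_or_ne j 0 with rfl | hj0
    · by_cases hi' : i + 1 < p
      · left; rw [← C.c_X_succ i 0 hi' hj, h, C.c_Y_zero _ hi']
      · right; rw [show i = p - 1 by omega]
        exact Ideal.mem_span_pair.2 ⟨1, 0, by simp⟩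
    · exact Or.inr (Y_mem _ i j hj0)
  obtain ⟨u, v, h⟩ := Ideal.mem_span_pair.1 this
  exact ⟨u, v, by rw [← h]; ring⟩

lemma mem_of_c (C : Coords (k := k) p X Y)
    (r : R) (h : C.c 0 0 r = 0) : ∃ u v, r = X * u + Y * v := by
  have : r ∈ Ideal.span {X, Y} := by
    refine C.mem_aux _ r fun i j hi hj => ?_
    rcases eq_or_ne j 0 with rfl | hj0
    · rcases i with _ | i
      · left; exact h
      · right; exact Ideal.mem_span_pair.2 ⟨X ^ i, 0, by rw [pow_succ]; ring⟩
    · exact Or.inr (Y_mem _ i j hj0)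
  obtain ⟨u, v, h⟩ := Ideal.mem_span_pair.1 this
  exact ⟨u, v, by rw [← h]; ring⟩

lemma exact_X' (C : Coords (k := k) p X Y)
    (hp : 0 < p) (r t : R) (h : X ^ (p - 1) * r = Y * t) :
    ∃ u v, r = X * u + Y * v := by
  refine C.mem_of_c r ?_
  rw [← C.c_X_pow (p - 1) 0 (by omega) hp, h, C.c_Y_zero _ (by omega)]

lemma exact_aug (C : Coords (k := k) p X Y)
    (hp : 1 < p) (ε : R →ₐ[k] k) (hX : ε X = 0) (hY : ε Y = 0) (r : R) (h : ε r = 0) :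
    ∃ u v, r = X * u + Y * v := by
  refine C.mem_of_c r ?_
  have h1 : C.c 0 0 1 = 1 := by
    simpa using C.c_mon 0 0 0 0 (by omega) (by omega) (by omega) (by omega)
  obtain ⟨u, v, huv⟩ := C.mem_of_c (r - algebraMap k R (C.c 0 0 r)) (by
    rw [map_sub, Algebra.algebraMap_eq_smul_one, map_smul, h1]; simp)
  have := congrArg ε huv
  simpa [h, hX, hY] using this

end Coords

/-- alternating `Z`, `Z^(p-1)`. -/
def alt {R : Type} [CommRing R] (p : ℕ) (Z : R) (n : ℕ) : R := if Even n then Z else Z ^ (p - 1)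

lemma alt_mul_succ {R : Type} [CommRing R] {p : ℕ} (hp : 1 < p) {Z : R} (hZ : Z ^ p = 0) (n : ℕ) :
    alt p Z n * alt p Z (n + 1) = 0 := by
  have h : Z * Z ^ (p - 1) = 0 := by rw [← pow_succ', Nat.sub_add_cancel hp.le, hZ]
  unfold alt
  by_cases hn : Even n
  · rw [if_pos hn, if_neg (by simpa [Nat.even_add_one] using hn), h]
  · rw [if_neg hn, if_pos (by simpa [Nat.even_add_one] using hn), mul_comm, h]

lemma alt_add_two {R : Type} [CommRing R] (p : ℕ) (Z : R) (n : ℕ) :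
    alt p Z (n + 2) = alt p Z n := by
  simp [alt, Nat.even_add]

section resolution

open CategoryTheory

variable (k G : Type) [Field k] [CommGroup G]

/-- The representation `R^(n+1)`. -/
noncomputable def Prep (n : ℕ) : Representation k G (Fin (n + 1) → MonoidAlgebra k G) where
  toFun g := (LinearMap.mulLeft k (MonoidAlgebra.of k G g)).compLeft (Fin (n + 1))
  map_one' := by ext; simp
  map_mul' g h := by
    apply LinearMap.ext; intro z; funext i
    simp only [map_mul, LinearMap.compLeft_apply, Function.comp, LinearMap.mulLeft_apply,
      Module.End.mul_apply, mul_assoc]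

lemma Prep_apply (n : ℕ) (g : G) (z : Fin (n + 1) → MonoidAlgebra k G) (i : Fin (n + 1)) :
    Prep k G n g z i = MonoidAlgebra.of k G g * z i := rfl

/-- free objects -/
noncomputable abbrev PP (n : ℕ) : Rep.{0} k G := Rep.of (Prep k G n)

variable {k G}

/-- universal property -/
noncomputable def liftP (A : Rep.{0} k G) {n : ℕ} (a : Fin (n + 1) → A) : PP k G n ⟶ A :=
  Rep.ofHom (LinearMap.intertwiningMap_of_isIntertwiningMap (Prep k G n) A.ρ
    (∑ j, (LinearMap.applyₗ (a j)) ∘ₗ A.ρ.asAlgebraHom.toLinearMap ∘ₗ LinearMap.proj j) (by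
      intro g v
      simp only [LinearMap.sum_apply, LinearMap.comp_apply, LinearMap.proj_apply, Prep_apply,
        AlgHom.toLinearMap_apply, map_mul, LinearMap.applyₗ_apply_apply, map_sum,
        Module.End.mul_apply, Representation.asAlgebraHom_of]))

lemma liftP_apply (A : Rep.{0} k G) {n : ℕ} (a : Fin (n + 1) → A)
    (z : Fin (n + 1) → MonoidAlgebra k G) :
    (liftP A a).hom z = ∑ j, A.ρ.asAlgebraHom (z j) (a j) := by
  change (∑ j, (LinearMap.applyₗ (a j)) ∘ₗ A.ρ.asAlgebraHom.toLinearMap ∘ₗ LinearMap.proj j) z = _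
  simp only [LinearMap.sum_apply, LinearMap.comp_apply, LinearMap.proj_apply, 
        AlgHom.toLinearMap_apply, LinearMap.applyₗ_apply_apply]

lemma hom_smul {A : Rep.{0} k G} {n : ℕ} (f : PP k G n ⟶ A) (r : MonoidAlgebra k G)
    (z : Fin (n + 1) → MonoidAlgebra k G) :
    f.hom (r • z) = A.ρ.asAlgebraHom r (f.hom z) := by
  induction r using MonoidAlgebra.induction_on with
  | of g =>
    rw [Representation.asAlgebraHom_of]
    exact Representation.IntertwiningMap.isIntertwining _ _ f.hom g z
  | add r s hr hs =>
    rw [add_smul, map_add, map_add, hr, hs]; rfl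
  | smul c r hr =>
    rw [smul_assoc, map_smul f.hom c, map_smul A.ρ.asAlgebraHom c, hr]; rfl

lemma hom_eq {A : Rep.{0} k G} {n : ℕ} (f : PP k G n ⟶ A) :
    f = liftP A (fun j => f.hom (Pi.single j (1 : MonoidAlgebra k G))) := by
  apply Rep.hom_ext; apply Representation.IntertwiningMap.ext; apply LinearMap.ext; intro z
  change f.hom z = (liftP A _).hom z
  rw [liftP_apply]
  have : z = ∑ j, z j • (Pi.single j (1 : MonoidAlgebra k G) : Fin (n + 1) → MonoidAlgebra k G) := by
    conv_lhs => rw [← Finset.univ_sum_single z]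
    refine Finset.sum_congr rfl fun j _ => ?_
    rw [← Pi.single_smul', smul_eq_mul, mul_one]
  conv_lhs => rw [this]
  rw [map_sum]
  exact Finset.sum_congr rfl fun j _ => hom_smul f _ _

lemma liftP_single (A : Rep.{0} k G) {n : ℕ} (a : Fin (n + 1) → A) (j : Fin (n + 1)) :
    (liftP A a).hom (Pi.single j (1 : MonoidAlgebra k G)) = a j := by
  rw [liftP_apply, Finset.sum_eq_single j]
  · rw [Pi.single_eq_same, map_one]; rfl
  · intro i _ hi
    rw [Pi.single_eq_of_ne hi, map_zero]; rfl
  · simp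

instance (n : ℕ) : Projective (PP k G n) where
  factors {E B} f e he := by
    rw [Rep.epi_iff_surjective] at he
    choose s hs using he
    refine ⟨liftP E (fun j => s (f.hom (Pi.single j (1 : MonoidAlgebra k G)))), ?_⟩
    rw [hom_eq f, hom_eq (liftP E _ ≫ e)]
    congr 1
    funext j
    change e.hom ((liftP E _).hom _) = _
    rw [liftP_single, hs, liftP_single]

variable (p : ℕ) (X Y : MonoidAlgebra k G)

/-- differential -/
noncomputable def dLin (n : ℕ) :
    (Fin (n + 2) → MonoidAlgebra k G) →ₗ[k] (Fin (n + 1) → MonoidAlgebra k G) where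
  toFun z i := alt p X (n + i) * z i.castSucc + (-1) ^ (n + i : ℕ) * alt p Y i * z i.succ
  map_add' z w := by funext i; simp only [Pi.add_apply]; ring
  map_smul' c z := by
    funext i; simp only [Pi.smul_apply, RingHom.id_apply, smul_add, mul_smul_comm]

lemma dLin_apply (n : ℕ) (z : Fin (n + 2) → MonoidAlgebra k G) (i : Fin (n + 1)) :
    dLin p X Y n z i = 
      alt p X (n + i) * z i.castSucc + (-1) ^ (n + i : ℕ) * alt p Y i * z i.succ := rfl

/-- differential in Rep -/
noncomputable def dP (n : ℕ) : PP k G (n + 1) ⟶ PP k G n :=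
  Rep.ofHom (LinearMap.intertwiningMap_of_isIntertwiningMap (Prep k G (n + 1)) (Prep k G n)
    (dLin p X Y n) (by
      intro g v
      funext i
      simp only [dLin_apply, Prep_apply]
      ring))

lemma dP_apply (n : ℕ) (z : Fin (n + 2) → MonoidAlgebra k G) :
    (dP p X Y n).hom z = dLin p X Y n z := rfl

variable {p X Y}

lemma dLin_comp (hp : 1 < p) (hX : X ^ p = 0) (hY : Y ^ p = 0) (n : ℕ)
    (z : Fin (n + 3) → MonoidAlgebra k G) : dLin p X Y n (dLin p X Y (n + 1) z) = 0 := by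
  funext i
  simp only [dLin_apply, Fin.val_castSucc, Fin.val_succ, Pi.zero_apply, Fin.succ_castSucc]
  have h1 := alt_mul_succ hp hX (n + i)
  have h2 := alt_mul_succ hp hY i
  rw [show n + 1 + (i : ℕ) = n + i + 1 by ring, show n + 1 + ((i : ℕ) + 1) = n + i + 2 by ring,
    alt_add_two, pow_succ, pow_succ]
  linear_combination z i.castSucc.castSucc * h1 - z i.succ.succ * h2 * (-1) ^ (n + i : ℕ) *
    (-1) ^ (n + i + 1 : ℕ)

/-- resolution complex -/
noncomputable def cplx (hp : 1 < p) (hX : X ^ p = 0) (hY : Y ^ p = 0) :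
    ChainComplex (Rep.{0} k G) ℕ :=
  ChainComplex.of (fun n => PP k G n) (fun n => dP p X Y n) (fun n => by
    apply Rep.hom_ext; apply Representation.IntertwiningMap.ext; apply LinearMap.ext; intro z
    exact dLin_comp hp hX hY n z)

lemma cplx_d (hp : 1 < p) (hX : X ^ p = 0) (hY : Y ^ p = 0) (n : ℕ) :
    (cplx (k := k) hp hX hY).d (n + 1) n = dP p X Y n := by
  exact ChainComplex.of_d _ _ _


/-- Exactness in positive degree. -/
lemma dLin_exact (C : Coords (k := k) p X Y) (hp : 1 < p) (n : ℕ) (z : Fin (n + 2) → MonoidAlgebra k G)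
    (hz : dLin p X Y n z = 0) : ∃ w, dLin p X Y (n + 1) w = z := by
  -- extend `z` to natural numbers
  let z' : ℕ → MonoidAlgebra k G := fun j => if h : j < n + 2 then z ⟨j, h⟩ else 0
  have hz' : ∀ j, j ≤ n → alt p X (n + j) * z' j + (-1) ^ (n + j) * alt p Y j * z' (j + 1) = 0 := by
    intro j hj
    have := congrFun hz ⟨j, by omega⟩
    rw [dLin_apply] at this
    simp only [z', dif_pos (show j < n + 2 by omega), dif_pos (show j + 1 < n + 2 by omega)]
    exact this
  have key : ∀ m, m ≤ n + 1 → ∃ w : ℕ → MonoidAlgebra k G, ∀ j, j ≤ m → z' j =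
      alt p X (n + 1 + j) * w j + (-1) ^ (n + 1 + j) * alt p Y j * w (j + 1) := by
    intro m
    induction m with
    | zero =>
      intro _
      have h0 := hz' 0 (by omega)
      have : ∃ u v, z' 0 = alt p X (n + 1) * u + Y * v := by
        have hY0 : alt p Y 0 = Y := by simp [alt]
        rw [hY0] at h0
        have h0' : alt p X n * z' 0 = Y * (-(-1) ^ n * z' 1) := by
          simp only [add_zero, zero_add] at h0
          linear_combination h0
        unfold alt at h0' ⊢
        by_cases hn : Even n
        · rw [if_pos hn] at h0'
          rw [if_neg (by simpa [Nat.even_add_one] using hn)]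
          exact C.exact_X _ _ h0'
        · rw [if_neg hn] at h0'
          rw [if_pos (by simpa [Nat.even_add_one] using hn)]
          exact C.exact_X' (by omega) _ _ h0'
      obtain ⟨u, v, huv⟩ := this
      refine ⟨fun j => if j = 0 then u else (-1) ^ (n + 1) * v, fun j hj => ?_⟩
      obtain rfl : j = 0 := by omega
      have hs : ((-1 : MonoidAlgebra k G) ^ (n + 1)) * (-1) ^ (n + 1) = 1 := by
        rw [← mul_pow]; simp
      simp only [if_true, add_zero, zero_add, one_ne_zero, if_false, alt]
      rw [huv]
      simp only [alt, Even.zero, if_true]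
      linear_combination (-Y * v) * hs
    | succ m ih =>
      intro hm
      obtain ⟨w, hw⟩ := ih (by omega)
      have h1 := hz' m (by omega)
      have h2 := hw m le_rfl
      have h3 := alt_mul_succ hp C.Xp (n + m)
      have hs : ((-1 : MonoidAlgebra k G) ^ (n + m)) * (-1) ^ (n + m) = 1 := by
        rw [← mul_pow]; simp
      have h4 : alt p Y m * (z' (m + 1) - alt p X (n + m) * w (m + 1)) = 0 := by
        rw [h2, show n + 1 + m = n + m + 1 by ring] at h1
        have h5 : (-1 : MonoidAlgebra k G) ^ (n + m) *
          (alt p Y m * (z' (m + 1) - alt p X (n + m) * w (m + 1))) = 0 := by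
          rw [pow_succ] at h1
          linear_combination h1 - w m * h3
        calc _ = ((-1 : MonoidAlgebra k G) ^ (n + m) * (-1) ^ (n + m)) * 
              (alt p Y m * (z' (m + 1) - alt p X (n + m) * w (m + 1))) := by rw [hs, one_mul]
          _ = 0 := by rw [mul_assoc, h5, mul_zero]
      have : ∃ t, z' (m + 1) - alt p X (n + m) * w (m + 1) = alt p Y (m + 1) * t := by
        generalize z' (m + 1) - alt p X (n + m) * w (m + 1) = q at h4 ⊢
        unfold alt at h4 ⊢
        by_cases hn : Even m
        · rw [if_pos hn] at h4
          rw [if_neg (by simpa [Nat.even_add_one] using hn)]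
          exact C.exact_Y _ h4
        · rw [if_neg hn] at h4
          rw [if_pos (by simpa [Nat.even_add_one] using hn)]
          exact C.exact_Y' (by omega) _ h4
      obtain ⟨t, ht⟩ := this
      refine ⟨Function.update w (m + 2) ((-1) ^ (n + m) * t), fun j hj => ?_⟩
      by_cases hjm : j ≤ m
      · rw [Function.update_of_ne (by omega), Function.update_of_ne (by omega)]
        exact hw j hjm
      · obtain rfl : j = m + 1 := by omega
        rw [Function.update_of_ne (by omega), Function.update_self,
          show n + 1 + (m + 1) = n + m + 2 by ring, alt_add_two, pow_add]
        linear_combination ht - alt p Y (m + 1) * t * hs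
  obtain ⟨w, hw⟩ := key (n + 1) le_rfl
  refine ⟨fun j => w j, ?_⟩
  funext i
  rw [dLin_apply]
  have := hw i (by omega)
  simp only [z', dif_pos (show (i : ℕ) < n + 2 from i.2)] at this
  exact this.symm

end resolution

section resolution2

open CategoryTheory

variable {k G : Type} [Field k] [CommGroup G]

variable (k G) in
/-- augmentation -/
noncomputable def aug : MonoidAlgebra k G →ₐ[k] k := MonoidAlgebra.lift k k G 1

lemma aug_of (g : G) : aug k G (MonoidAlgebra.of k G g) = 1 := by
  simp [aug]

variable (k G) in
/-- augmentation in Rep -/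
noncomputable def augP : PP k G 0 ⟶ Rep.trivial k G k :=
  Rep.ofHom (LinearMap.intertwiningMap_of_isIntertwiningMap (Prep k G 0)
    (Representation.trivial k G k) ((aug k G).toLinearMap ∘ₗ LinearMap.proj 0) (by
      intro g v
      simp only [LinearMap.comp_apply, LinearMap.proj_apply, Prep_apply,
        AlgHom.toLinearMap_apply, map_mul, aug_of, one_mul, Representation.trivial_apply]))

lemma augP_apply (z : Fin 1 → MonoidAlgebra k G) : (augP k G).hom z = aug k G (z 0) := rfl

variable {p : ℕ} {X Y : MonoidAlgebra k G}

lemma dP_augP (hX : aug k G X = 0) (hY : aug k G Y = 0) : dP p X Y 0 ≫ augP k G = 0 := by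
  apply Rep.hom_ext; apply Representation.IntertwiningMap.ext; apply LinearMap.ext; intro z
  change aug k G (dLin p X Y 0 z 0) = 0
  rw [dLin_apply]
  simp [alt, hX, hY]

variable (C : Coords (k := k) p X Y)

/-- The map to the trivial module. -/
noncomputable def piP (hp : 1 < p) (hX : aug k G X = 0) (hY : aug k G Y = 0) :
    cplx (k := k) hp C.Xp C.Yp ⟶ (ChainComplex.single₀ (Rep.{0} k G)).obj (Rep.trivial k G k) :=
  ((cplx hp C.Xp C.Yp).toSingle₀Equiv _).symm ⟨augP k G, by
    rw [cplx_d]; exact dP_augP hX hY⟩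

lemma piP_quasiIso (hp : 1 < p) (hX : aug k G X = 0) (hY : aug k G Y = 0) :
    QuasiIso (piP C hp hX hY) where
  quasiIsoAt m := by
    induction m with
    | zero =>
      rw [ChainComplex.quasiIsoAt₀_iff, ShortComplex.quasiIso_iff_of_zeros' _ rfl rfl rfl]
      have hf : (piP C hp hX hY).f 0 = augP k G := by
        simp [piP]
        rfl
      constructor
      · apply (forget₂ _ (ModuleCat k)).reflects_exact_of_faithful
        rw [ShortComplex.moduleCat_exact_iff]
        intro (z : Fin 1 → MonoidAlgebra k G) hz
        change ((piP C hp hX hY).f 0).hom z = 0 at hz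
        rw [hf] at hz
        have hz' : aug k G (z 0) = 0 := hz
        obtain ⟨u, v, huv⟩ := C.exact_aug hp _ hX hY _ hz'
        refine ⟨(![u, v] : Fin 2 → MonoidAlgebra k G), ?_⟩
        change ((cplx (k := k) hp C.Xp C.Yp).d 1 0).hom _ = _
        rw [cplx_d]
        change dLin p X Y 0 ![u, v] = z
        funext i
        obtain rfl : i = 0 := Fin.fin_one_eq_zero i
        rw [dLin_apply, huv]
        simp [alt]
      · rw [Rep.epi_iff_surjective]
        intro x
        refine ⟨(fun _ => algebraMap k _ x : Fin 1 → MonoidAlgebra k G), ?_⟩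
        change ((piP C hp hX hY).f 0).hom _ = _
        rw [hf]
        exact (aug k G).commutes x
    | succ m _ =>
      rw [quasiIsoAt_iff_exactAt' (hL := ChainComplex.exactAt_succ_single_obj ..),
          HomologicalComplex.exactAt_iff' _ (m + 2) (m + 1) m (by simp) (by simp)]
      apply (forget₂ _ (ModuleCat k)).reflects_exact_of_faithful
      rw [ShortComplex.moduleCat_exact_iff]
      intro (z : Fin (m + 2) → MonoidAlgebra k G) hz
      change ((cplx (k := k) hp C.Xp C.Yp).d (m + 1) m).hom z = 0 at hz
      rw [cplx_d] at hz
      obtain ⟨w, hw⟩ := dLin_exact C hp m z hz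
      refine ⟨w, ?_⟩
      change ((cplx (k := k) hp C.Xp C.Yp).d (m + 2) (m + 1)).hom w = z
      rw [cplx_d]
      exact hw

/-- The resolution. -/
noncomputable def resP (hp : 1 < p) (hX : aug k G X = 0) (hY : aug k G Y = 0) :
    ProjectiveResolution (Rep.trivial k G k) where
  complex := cplx hp C.Xp C.Yp
  projective n := inferInstanceAs (Projective (PP k G n))
  π := piP C hp hX hY
  quasiIso := piP_quasiIso C hp hX hY

lemma finrank_homology_sc (S : ShortComplex (ModuleCat.{0} k))
    [FiniteDimensional k S.X₁] [FiniteDimensional k S.X₂] :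
    Module.finrank k S.homology + Module.finrank k S.X₁ =
      Module.finrank k (LinearMap.ker S.f.hom) + Module.finrank k (LinearMap.ker S.g.hom) := by
  rw [S.moduleCatHomologyIso.toLinearEquiv.finrank_eq]
  have h1 := Submodule.finrank_quotient_add_finrank (LinearMap.range S.moduleCatToCycles)
  have h2 := LinearMap.finrank_range_add_finrank_ker S.moduleCatToCycles
  have h3 : LinearMap.ker S.moduleCatToCycles = LinearMap.ker S.f.hom :=
    LinearMap.ker_codRestrict _ _ _
  rw [h3] at h2
  change Module.finrank k (_ ⧸ (LinearMap.range S.moduleCatToCycles)) + _ = _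
  omega

lemma finrank_homology_zero (K : CochainComplex (ModuleCat.{0} k) ℕ)
    [∀ i, FiniteDimensional k (K.X i)] :
    Module.finrank k (K.homology 0) = Module.finrank k (LinearMap.ker (K.d 0 1).hom) := by
  have e : K.homology 0 ≅ (K.sc' 0 0 1).homology :=
    ShortComplex.homologyMapIso (K.isoSc' 0 0 1 (by simp) (by simp))
  rw [e.toLinearEquiv.finrank_eq]
  have : FiniteDimensional k (K.sc' 0 0 1).X₁ := inferInstanceAs (FiniteDimensional k (K.X 0))
  have : FiniteDimensional k (K.sc' 0 0 1).X₂ := inferInstanceAs (FiniteDimensional k (K.X 0))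
  have h := finrank_homology_sc (K.sc' 0 0 1)
  have h0 : (K.sc' 0 0 1).f.hom = 0 := by
    have : (K.sc' 0 0 1).f = 0 := K.shape 0 0 (by simp)
    rw [this]; rfl
  rw [h0, LinearMap.ker_zero, finrank_top, add_comm] at h
  exact Nat.add_left_cancel h

lemma finrank_homology_succ (K : CochainComplex (ModuleCat.{0} k) ℕ) (n : ℕ)
    [∀ i, FiniteDimensional k (K.X i)] :
    Module.finrank k (K.homology (n + 1)) + Module.finrank k (K.X n) =
      Module.finrank k (LinearMap.ker (K.d n (n + 1)).hom) +
      Module.finrank k (LinearMap.ker (K.d (n + 1) (n + 2)).hom) := by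
  have e : K.homology (n + 1) ≅ (K.sc' n (n + 1) (n + 2)).homology :=
    ShortComplex.homologyMapIso (K.isoSc' n (n + 1) (n + 2) (by simp) (by simp))
  rw [e.toLinearEquiv.finrank_eq]
  have : FiniteDimensional k (K.sc' n (n + 1) (n + 2)).X₁ :=
    inferInstanceAs (FiniteDimensional k (K.X n))
  have : FiniteDimensional k (K.sc' n (n + 1) (n + 2)).X₂ :=
    inferInstanceAs (FiniteDimensional k (K.X (n + 1)))
  exact finrank_homology_sc (K.sc' n (n + 1) (n + 2))

end resolution2

section cocycles

open CategoryTheory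

variable {k V : Type} [Field k] [AddCommGroup V] [Module k V]

/-- Cocycle space. -/
def KK (D E : ℕ → Module.End k V) (n : ℕ) : Submodule k (ℕ → V) where
  carrier := {a | (∀ j, n < j → a j = 0) ∧ D n (a 0) = 0 ∧
    ∀ j, D (n + j + 1) (a (j + 1)) + (-1 : k) ^ (n + j) • E j (a j) = 0}
  zero_mem' := by simp
  add_mem' := by
    rintro a b ⟨h1, h2, h3⟩ ⟨g1, g2, g3⟩
    refine ⟨fun j hj => ?_, ?_, fun j => ?_⟩
    · simp [h1 j hj, g1 j hj]
    · simp [h2, g2]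
    · have := congrArg₂ (· + ·) (h3 j) (g3 j)
      simp only [add_zero] at this
      rw [← this]
      simp only [Pi.add_apply, map_add, smul_add]
      abel
  smul_mem' := by
    rintro c a ⟨h1, h2, h3⟩
    refine ⟨fun j hj => ?_, ?_, fun j => ?_⟩
    · simp [h1 j hj]
    · simp [h2]
    · have := congrArg (c • ·) (h3 j)
      simp only [smul_zero] at this
      rw [← this]
      simp only [Pi.smul_apply, map_smul, smul_add]
      rw [smul_comm c]

lemma mem_KK {D E : ℕ → Module.End k V} {n : ℕ} {a : ℕ → V} : a ∈ KK D E n ↔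
    (∀ j, n < j → a j = 0) ∧ D n (a 0) = 0 ∧
    ∀ j, D (n + j + 1) (a (j + 1)) + (-1 : k) ^ (n + j) • E j (a j) = 0 := Iff.rfl

/-- degree zero -/
noncomputable def KK_zero (D E : ℕ → Module.End k V) :
    KK D E 0 ≃ₗ[k] (LinearMap.ker (D 0) ⊓ LinearMap.ker (E 0) : Submodule k V) where
  toFun a := ⟨a.1 0, by
    obtain ⟨a, h1, h2, h3⟩ := a
    refine ⟨h2, ?_⟩
    have := h3 0
    rw [h1 _ (by omega)] at this
    simpa using this⟩
  map_add' a b := rfl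
  map_smul' c b := rfl
  invFun u := ⟨fun j => if j = 0 then u.1 else 0, by
    obtain ⟨u, h1, h2⟩ := u
    have h1 : D 0 u = 0 := h1
    have h2 : E 0 u = 0 := h2
    refine ⟨fun j hj => if_neg (by omega), by simpa using h1, fun j => ?_⟩
    by_cases hj : j = 0
    · subst hj; simp [h2]
    · simp [hj]⟩
  left_inv a := by
    obtain ⟨a, h1, h2, h3⟩ := a
    apply Subtype.ext
    funext j
    by_cases hj : j = 0
    · simp [hj]
    · simp [hj, h1 j (by omega)]
  right_inv u := by
    apply Subtype.ext
    simp

/-- degree one -/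
noncomputable def KK_one (D E : ℕ → Module.End k V) (hE1 : E 1 = 0) (s : Module.End k V)
    (hD2 : D 2 = D 0) (hs : ∀ v, D 0 (s v) = E 0 v) :
    KK D E 1 ≃ₗ[k] (LinearMap.ker (D 1) × LinearMap.ker (D 0)) where
  toFun a := (⟨a.1 0, a.2.2.1⟩, ⟨a.1 1 - s (a.1 0), by
    have := a.2.2.2 0
    simp only [hD2, zero_add, add_zero, pow_one, neg_smul, one_smul] at this
    rw [LinearMap.mem_ker, map_sub, hs, sub_eq_add_neg]; exact this⟩)
  map_add' a b := by
    refine Prod.ext rfl (Subtype.ext ?_)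
    change (a.1 1 + b.1 1) - s (a.1 0 + b.1 0) = (a.1 1 - s (a.1 0)) + (b.1 1 - s (b.1 0))
    rw [map_add]; abel
  map_smul' c a := by
    refine Prod.ext rfl (Subtype.ext ?_)
    change (c • a.1 1) - s (c • a.1 0) = c • (a.1 1 - s (a.1 0))
    rw [map_smul, smul_sub]
  invFun u := ⟨fun j => if j = 0 then u.1.1 else if j = 1 then u.2.1 + s u.1.1 else 0, by
    obtain ⟨⟨u, hu⟩, ⟨v, hv⟩⟩ := u
    rw [LinearMap.mem_ker] at hu hv
    refine ⟨fun j hj => ?_, by simpa using hu, fun j => ?_⟩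
    · dsimp only
      rw [if_neg (by omega), if_neg (by omega)]
    · rcases j with _ | _ | j
      · simp [hD2, hv, hs]
      · simp [hE1]
      · simp⟩
  left_inv a := by
    obtain ⟨a, h1, h2, h3⟩ := a
    apply Subtype.ext
    funext j
    rcases j with _ | _ | j
    · simp
    · simp
    · simp [h1 (j + 2) (by omega)]
  right_inv u := by
    refine Prod.ext (Subtype.ext ?_) (Subtype.ext ?_) <;> simp

/-- induction step -/
noncomputable def KK_step (D E : ℕ → Module.End k V) (n : ℕ) (hE1 : E 1 = 0) (s : Module.End k V)
    (hD2 : ∀ m, D (m + 2) = D m) (hE2 : ∀ m, E (m + 2) = E m)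
    (hs : ∀ v, D (n + 1) (s v) = E 0 v) :
    KK D E (n + 2) ≃ₗ[k] ((LinearMap.ker (D n) × LinearMap.ker (D (n + 1))) × KK D E n) where
  toFun a := ((⟨a.1 0, by
      have := a.2.2.1
      rwa [hD2] at this⟩, ⟨a.1 1 + (-1 : k) ^ n • s (a.1 0), by
    have := a.2.2.2 0
    simp only [add_zero, show n + 2 + 1 = (n + 1) + 2 by ring, hD2, zero_add, pow_add _ n 2,
      neg_one_sq, mul_one] at this
    rw [LinearMap.mem_ker, map_add, map_smul, hs]; exact this⟩), ⟨fun j => a.1 (j + 2), by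
      obtain ⟨a, h1, h2, h3⟩ := a
      refine ⟨fun j hj => h1 _ (by omega), ?_, fun j => ?_⟩
      · have := h3 1
        rw [hE1, show n + 2 + 1 + 1 = (n + 2) + 2 by ring, hD2, hD2] at this
        simpa using this
      · have := h3 (j + 2)
        rw [show n + 2 + (j + 2) + 1 = (n + j + 1 + 2) + 2 by ring, hD2, hD2, hE2, 
          show n + 2 + (j + 2) = n + j + 2 + 2 by ring, pow_add, pow_add, neg_one_sq, mul_one,
          mul_one] at this
        exact this⟩)
  map_add' a b := by
    refine Prod.ext (Prod.ext rfl (Subtype.ext ?_)) rfl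
    change (a.1 1 + b.1 1) + (-1 : k) ^ n • s (a.1 0 + b.1 0) =
      (a.1 1 + (-1 : k) ^ n • s (a.1 0)) + (b.1 1 + (-1 : k) ^ n • s (b.1 0))
    rw [map_add, smul_add]; abel
  map_smul' c a := by
    refine Prod.ext (Prod.ext rfl (Subtype.ext ?_)) rfl
    change (c • a.1 1) + (-1 : k) ^ n • s (c • a.1 0) = c • (a.1 1 + (-1 : k) ^ n • s (a.1 0))
    rw [map_smul, smul_add, smul_comm c]
  invFun u := ⟨fun j => if j = 0 then u.1.1.1 else if j = 1 then
      u.1.2.1 - (-1 : k) ^ n • s u.1.1.1 else u.2.1 (j - 2), by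
    obtain ⟨⟨⟨u, hu⟩, ⟨v, hv⟩⟩, ⟨b, h1, h2, h3⟩⟩ := u
    rw [LinearMap.mem_ker] at hu hv
    refine ⟨fun j hj => ?_, by simpa [hD2] using hu, fun j => ?_⟩
    · dsimp only
      rw [if_neg (by omega), if_neg (by omega)]
      exact h1 _ (by omega)
    · rcases j with _ | _ | j
      · simp only [add_zero, show n + 2 + 1 = (n + 1) + 2 by ring, hD2, zero_add, pow_add _ n 2,
          neg_one_sq, mul_one, one_ne_zero, if_false, if_true, map_sub, hv, map_smul, hs, zero_sub,
          neg_add_cancel]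
      · rw [zero_add, hE1, show n + 2 + 1 + 1 = (n + 2) + 2 by ring, hD2, hD2]
        simpa using h2
      · rw [show n + 2 + (j + 2) + 1 = (n + j + 1 + 2) + 2 by ring, hD2, hD2, hE2, 
          show n + 2 + (j + 2) = n + j + 2 + 2 by ring, pow_add, pow_add, neg_one_sq, mul_one,
          mul_one]
        exact h3 j⟩
  left_inv a := by
    obtain ⟨a, h1, h2, h3⟩ := a
    apply Subtype.ext
    funext j
    rcases j with _ | _ | j
    · simp
    · simp
    · simp 
  right_inv u := by
    refine Prod.ext (Prod.ext (Subtype.ext ?_) (Subtype.ext ?_)) (Subtype.ext ?_) <;> simp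

end cocycles

section homs

open CategoryTheory

variable {k G : Type} [Field k] [CommGroup G]

/-- evaluation on generators -/
noncomputable def homEquiv (A : Rep.{0} k G) (n : ℕ) :
    (PP k G n ⟶ A) ≃ₗ[k] (Fin (n + 1) → A) where
  toFun f := fun j => f.hom (Pi.single j (1 : MonoidAlgebra k G))
  map_add' f g := rfl
  map_smul' c f := rfl
  invFun a := liftP A a
  left_inv f := (hom_eq f).symm
  right_inv a := by
    funext j; exact liftP_single A a j

variable (p : ℕ) (X Y : MonoidAlgebra k G) (A : Rep.{0} k G)

lemma comp_apply_sum (n : ℕ) (a : ℕ → A) (ha : a (n + 1) = 0) (z : ℕ → MonoidAlgebra k G) :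
    (dP p X Y n ≫ liftP A (fun j => a j)).hom (fun j => z j) =
      A.ρ.asAlgebraHom (z 0) (A.ρ.asAlgebraHom (alt p X n) (a 0)) + ∑ j ∈ range (n + 1),
        A.ρ.asAlgebraHom (z (j + 1)) (A.ρ.asAlgebraHom (alt p X (n + j + 1)) (a (j + 1)) +
          (-1 : k) ^ (n + j) • A.ρ.asAlgebraHom (alt p Y j) (a j)) := by
  change (liftP A (fun j => a j)).hom (dLin p X Y n (fun j => z j)) = _
  rw [liftP_apply]
  simp only [dLin_apply, Fin.val_castSucc, Fin.val_succ]
  rw [← Fin.sum_univ_eq_sum_range, Fin.sum_univ_eq_sum_range (fun j => A.ρ.asAlgebraHom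
    (alt p X (n + j) * z j + (-1) ^ (n + j) * alt p Y j * z (j + 1)) (a j)),
    Fin.sum_univ_eq_sum_range (fun j => A.ρ.asAlgebraHom (z (j + 1))
      (A.ρ.asAlgebraHom (alt p X (n + j + 1)) (a (j + 1)) +
          (-1 : k) ^ (n + j) • A.ρ.asAlgebraHom (alt p Y j) (a j)))]
  have h1 : ∀ j, A.ρ.asAlgebraHom
    (alt p X (n + j) * z j + (-1) ^ (n + j) * alt p Y j * z (j + 1)) (a j) =
      A.ρ.asAlgebraHom (z j) (A.ρ.asAlgebraHom (alt p X (n + j)) (a j)) +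
      A.ρ.asAlgebraHom (z (j + 1)) ((-1 : k) ^ (n + j) • A.ρ.asAlgebraHom (alt p Y j) (a j)) := by
    intro j
    have : alt p X (n + j) * z j + (-1) ^ (n + j) * alt p Y j * z (j + 1) =
      z j * alt p X (n + j) + (-1 : k) ^ (n + j) • (z (j + 1) * alt p Y j) := by
      rw [Algebra.smul_def, map_pow, map_neg, map_one]; ring
    rw [this, map_add, map_smul, map_mul, map_mul, map_smul]
    rfl
  simp only [h1]
  simp only [map_add, sum_add_distrib]
  rw [← add_assoc]
  congr 1
  have h2 := sum_range_succ (fun j => A.ρ.asAlgebraHom (z j)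
    (A.ρ.asAlgebraHom (alt p X (n + j)) (a j))) (n + 1)
  rw [sum_range_succ'] at h2
  rw [ha] at h2
  simp only [map_zero, add_zero] at h2
  rw [← h2, add_comm]
  rfl

lemma comp_eq_zero_iff (n : ℕ) (a : ℕ → A) (ha : ∀ j, n < j → a j = 0) :
    dP p X Y n ≫ liftP A (fun j => a j) = 0 ↔
      a ∈ KK (fun m => A.ρ.asAlgebraHom (alt p X m)) (fun m => A.ρ.asAlgebraHom (alt p Y m)) n := by
  rw [mem_KK]
  constructor
  · intro h
    have key : ∀ z : ℕ → MonoidAlgebra k G, _ := fun z =>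
      (comp_apply_sum p X Y A n a (ha _ (by omega)) z).symm.trans
        (show _ = 0 by rw [h]; rfl)
    refine ⟨ha, ?_, fun j => ?_⟩
    · have := key (fun j => if j = 0 then 1 else 0)
      simpa using this
    · by_cases hj : j < n + 1
      · have := key (fun i => if i = j + 1 then 1 else 0)
        rw [sum_eq_single j] at this
        · simpa using this
        · intro b _ hb
          simp [hb]
        · intro h; simp at h; omega
      · simp [ha j (by omega), ha (j + 1) (by omega)]
  · rintro ⟨_, h1, h2⟩
    apply Rep.hom_ext; apply Representation.IntertwiningMap.ext; apply LinearMap.ext; intro z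
    have := comp_apply_sum p X Y A n a (ha _ (by omega))
      (fun j => if h : j < n + 2 then z ⟨j, h⟩ else 0)
    rw [h1, sum_eq_zero (fun j _ => by rw [h2 j, map_zero])] at this
    simp only [Fin.is_lt, dif_pos, map_zero, add_zero] at this
    exact this

variable {p X Y}

lemma resP_d (C : Coords (k := k) p X Y) (hp : 1 < p) (hX : aug k G X = 0) (hY : aug k G Y = 0) (n : ℕ) (f : PP k G n ⟶ A) :
    (((resP C hp hX hY).complex.linearYonedaObj k A).d n (n + 1)).hom f = dP p X Y n ≫ f := by
  rw [← cplx_d hp C.Xp C.Yp]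
  rfl

/-- cocycles -/
noncomputable def kerEquiv (C : Coords (k := k) p X Y) (hp : 1 < p) (hX : aug k G X = 0) (hY : aug k G Y = 0) (n : ℕ) :
    LinearMap.ker (((resP C hp hX hY).complex.linearYonedaObj k A).d n (n + 1)).hom ≃ₗ[k]
      KK (fun m => A.ρ.asAlgebraHom (alt p X m)) (fun m => A.ρ.asAlgebraHom (alt p Y m)) n where
  toFun f := ⟨fun j => if h : j < n + 1 then homEquiv A n f.1 ⟨j, h⟩ else 0, by
    rw [← comp_eq_zero_iff]
    · have h1 := f.2
      rw [LinearMap.mem_ker] at h1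
      replace h1 := (resP_d A C hp hX hY n f.1).symm.trans h1
      have h2 : liftP A (homEquiv A n f.1) = f.1 := (homEquiv A n).symm_apply_apply _
      simp only [Fin.is_lt, dif_pos]
      exact (congrArg (fun t => dP p X Y n ≫ t) h2).trans h1
    · intro j hj
      rw [dif_neg (by omega)]⟩
  map_add' f g := by
    apply Subtype.ext
    funext j
    change (if h : j < n + 1 then homEquiv A n (f.1 + g.1) ⟨j, h⟩ else 0) =
      (if h : j < n + 1 then homEquiv A n f.1 ⟨j, h⟩ else 0) +
      (if h : j < n + 1 then homEquiv A n g.1 ⟨j, h⟩ else 0)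
    split_ifs
    · rfl
    · simp
  map_smul' c f := by
    apply Subtype.ext
    funext j
    change (if h : j < n + 1 then homEquiv A n (c • f.1) ⟨j, h⟩ else 0) =
      c • (if h : j < n + 1 then homEquiv A n f.1 ⟨j, h⟩ else 0)
    split_ifs
    · rfl
    · simp
  invFun a := ⟨liftP A (fun j => a.1 j), by
    refine (resP_d A C hp hX hY n _).trans ?_
    exact (comp_eq_zero_iff p X Y A n a.1 a.2.1).2 a.2⟩
  left_inv f := by
    apply Subtype.ext
    simp only [Fin.is_lt, dif_pos]
    exact (homEquiv A n).symm_apply_apply _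
  right_inv a := by
    apply Subtype.ext
    funext j
    by_cases h : j < n + 1
    · simp only [dif_pos h]
      exact congrFun ((homEquiv A n).apply_symm_apply (fun j => a.1 j)) ⟨j, h⟩
    · simp only [dif_neg h]
      exact (a.2.1 j (by omega)).symm

/-- Dimension count. -/
theorem finrank_of_data (C : Coords (k := k) p X Y) (hp : 1 < p) (hX : aug k G X = 0) (hY : aug k G Y = 0)
    [FiniteDimensional k A] (hA : Module.finrank k A = p + 1)
    (hE1 : A.ρ.asAlgebraHom (Y ^ (p - 1)) = 0) (s s' : Module.End k A)
    (hs : ∀ v, A.ρ.asAlgebraHom X (s v) = A.ρ.asAlgebraHom Y v)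
    (hs' : ∀ v, A.ρ.asAlgebraHom (X ^ (p - 1)) (s' v) = A.ρ.asAlgebraHom Y v)
    (h0 : Module.finrank k (LinearMap.ker (A.ρ.asAlgebraHom X) ⊓
      LinearMap.ker (A.ρ.asAlgebraHom Y) : Submodule k A) = 1)
    (h1 : Module.finrank k (LinearMap.ker (A.ρ.asAlgebraHom X)) = 2)
    (h2 : Module.finrank k (LinearMap.ker (A.ρ.asAlgebraHom (X ^ (p - 1)))) = p) (n : ℕ) :
    Module.finrank k (groupCohomology A n) = n + 1 := by
  rw [(groupCohomologyIso A n (resP C hp hX hY)).toLinearEquiv.finrank_eq]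
  set K := (resP C hp hX hY).complex.linearYonedaObj k A with hK
  have eK : ∀ m, K.X m ≃ₗ[k] (Fin (m + 1) → A) := fun m => homEquiv A m
  have fK : ∀ m, FiniteDimensional k (K.X m) := fun m => (eK m).symm.finiteDimensional
  have dK : ∀ m, Module.finrank k (K.X m) = (m + 1) * (p + 1) := by
    intro m
    rw [(eK m).finrank_eq, Module.finrank_pi_fintype]
    simp [hA]
  set D : ℕ → Module.End k A := fun m => A.ρ.asAlgebraHom (alt p X m) with hD
  set E : ℕ → Module.End k A := fun m => A.ρ.asAlgebraHom (alt p Y m) with hE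
  have eKer : ∀ m, LinearMap.ker (K.d m (m + 1)).hom ≃ₗ[k] KK D E m :=
    fun m => kerEquiv A C hp hX hY m
  have fKer : ∀ m, FiniteDimensional k (KK D E m) := fun m => (eKer m).finiteDimensional
  have hD0 : D 0 = A.ρ.asAlgebraHom X := by simp [D, alt]
  have hD1 : D 1 = A.ρ.asAlgebraHom (X ^ (p - 1)) := by simp [D, alt]
  have hE0 : E 0 = A.ρ.asAlgebraHom Y := by simp [E, alt]
  have hE1 : E 1 = 0 := by simpa [E, alt] using hE1
  have hD2 : ∀ m, D (m + 2) = D m := fun m => by simp only [D, alt_add_two]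
  have hE2 : ∀ m, E (m + 2) = E m := fun m => by simp only [E, alt_add_two]
  have par : ∀ m, (D m = D 0 ∧ D (m + 1) = D 1) ∨ (D m = D 1 ∧ D (m + 1) = D 0) := by
    intro m
    induction m with
    | zero => left; exact ⟨rfl, rfl⟩
    | succ m ih =>
      rw [show m + 1 + 1 = m + 2 by ring, hD2]
      tauto
  have k0 : Module.finrank k (KK D E 0) = 1 := by
    rw [(KK_zero D E).finrank_eq, hD0, hE0, h0]
  have k1 : Module.finrank k (KK D E 1) = p + 2 := by
    rw [(KK_one D E hE1 s (hD2 0) (by rw [hD0, hE0]; exact hs)).finrank_eq, Module.finrank_prod,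
      hD0, hD1, h1, h2]
  have k2 : ∀ m, Module.finrank k (KK D E (m + 2)) = Module.finrank k (KK D E m) + (p + 2) := by
    intro m
    have : ∃ t : Module.End k A, ∀ v, D (m + 1) (t v) = E 0 v := by
      rcases par (m + 1) with h | h
      · exact ⟨s, by rw [h.1, hD0, hE0]; exact hs⟩
      · exact ⟨s', by rw [h.1, hD1, hE0]; exact hs'⟩
    obtain ⟨t, ht⟩ := this
    rw [(KK_step D E m hE1 t hD2 hE2 ht).finrank_eq, Module.finrank_prod, Module.finrank_prod]
    rcases par m with h | h
    · rw [h.1, h.2, hD0, hD1, h1, h2]; ring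
    · rw [h.1, h.2, hD0, hD1, h1, h2]; ring
  have k3 : ∀ m, Module.finrank k (KK D E m) + Module.finrank k (KK D E (m + 1)) =
      (m + 1) * (p + 1) + (m + 2) := by
    intro m
    induction m with
    | zero => rw [k0, k1]; ring
    | succ m ih =>
      rw [k2 m]
      linarith
  rcases n with _ | n
  · rw [finrank_homology_zero, (eKer 0).finrank_eq, k0]
  · have := finrank_homology_succ K n
    rw [(eKer n).finrank_eq, (eKer (n + 1)).finrank_eq, k3, dK] at this
    linarith

end homs

section concrete

set_option linter.unusedSectionVars false

open CategoryTheory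

variable (p : ℕ) [Fact p.Prime] (k : Type) [Field k]

/-- The representation `M*`. -/
noncomputable abbrev AA : Rep.{0} k (ElemAbelian p) :=
  Rep.of (Representation.dual
        (Representation.ofModule (k := k) (G := ElemAbelian p) (genModule p k)))

/-- The space underlying `M`. -/
abbrev MM : Type := RestrictScalars k (MonoidAlgebra k (ElemAbelian p)) (genModule p k)

/-- The quotient map. -/
noncomputable def qq : MonoidAlgebra k (ElemAbelian p) →ₗ[k] MM p k where
  toFun r := (RestrictScalars.addEquiv k (MonoidAlgebra k (ElemAbelian p)) (genModule p k)).symm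
    (Ideal.Quotient.mk (genIdeal p k) r)
  map_add' r s := by simp
  map_smul' c r := by
    rw [RingHom.id_apply, Algebra.smul_def, map_mul,
      ← RestrictScalars.addEquiv_symm_map_algebraMap_smul]
    rfl

lemma qq_surj : Function.Surjective (qq p k) := by
  intro w
  obtain ⟨r, hr⟩ := Ideal.Quotient.mk_surjective
    (RestrictScalars.addEquiv k (MonoidAlgebra k (ElemAbelian p)) (genModule p k) w)
  refine ⟨r, ?_⟩
  change (RestrictScalars.addEquiv k (MonoidAlgebra k (ElemAbelian p)) (genModule p k)).symm
    (Ideal.Quotient.mk (genIdeal p k) r) = w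
  rw [hr, AddEquiv.symm_apply_apply]

lemma qq_eq_zero {r : MonoidAlgebra k (ElemAbelian p)} : qq p k r = 0 ↔ r ∈ genIdeal p k := by
  rw [← Ideal.Quotient.eq_zero_iff_mem]
  exact (RestrictScalars.addEquiv k (MonoidAlgebra k (ElemAbelian p))
    (genModule p k)).symm.map_eq_zero_iff

lemma ofModule_qq (g : ElemAbelian p) (r : MonoidAlgebra k (ElemAbelian p)) :
    Representation.ofModule (k := k) (G := ElemAbelian p) (genModule p k) g (qq p k r) =
      qq p k (MonoidAlgebra.of k _ g * r) := by
  rw [← Representation.asAlgebraHom_of, Representation.ofModule_asAlgebraHom_apply_apply]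
  rfl

lemma AA_of (g : ElemAbelian p) (φ : MM p k →ₗ[k] k) (r : MonoidAlgebra k (ElemAbelian p)) :
    ((AA p k).ρ.asAlgebraHom (MonoidAlgebra.of k _ g) φ : MM p k →ₗ[k] k) (qq p k r) =
      φ (qq p k (MonoidAlgebra.of k _ g⁻¹ * r)) := by
  rw [← ofModule_qq, Representation.asAlgebraHom_of]
  rfl

/-- `x - 1` acting on `M*`. -/
noncomputable def opX : Module.End k (MM p k →ₗ[k] k) := (AA p k).ρ.asAlgebraHom (xE p k (-1))

/-- `y - 1` acting on `M*`. -/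
noncomputable def opY : Module.End k (MM p k →ₗ[k] k) := (AA p k).ρ.asAlgebraHom (yE p k (-1))

lemma opX_apply (φ : MM p k →ₗ[k] k) (r : MonoidAlgebra k (ElemAbelian p)) :
    opX p k φ (qq p k r) = φ (qq p k (xE p k 1 * r)) := by
  have h := AA_of p k (Multiplicative.ofAdd ((-1 : ZMod p), (0 : ZMod p))) φ r
  have hg : (Multiplicative.ofAdd ((-1 : ZMod p), (0 : ZMod p)))⁻¹ =
      Multiplicative.ofAdd ((1 : ZMod p), (0 : ZMod p)) := by
    rw [← ofAdd_neg]; simp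
  rw [hg] at h
  rw [opX, xE, xE, sub_mul, one_mul, map_sub, map_sub, map_sub, ← h, map_one]
  rfl

lemma opY_apply (φ : MM p k →ₗ[k] k) (r : MonoidAlgebra k (ElemAbelian p)) :
    opY p k φ (qq p k r) = φ (qq p k (yE p k 1 * r)) := by
  have h := AA_of p k (Multiplicative.ofAdd ((0 : ZMod p), (-1 : ZMod p))) φ r
  have hg : (Multiplicative.ofAdd ((0 : ZMod p), (-1 : ZMod p)))⁻¹ =
      Multiplicative.ofAdd ((0 : ZMod p), (1 : ZMod p)) := by
    rw [← ofAdd_neg]; simp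
  rw [hg] at h
  rw [opY, yE, yE, sub_mul, one_mul, map_sub, map_sub, map_sub, ← h, map_one]
  rfl

lemma opX_pow (n : ℕ) (φ : MM p k →ₗ[k] k) (r : MonoidAlgebra k (ElemAbelian p)) :
    (opX p k ^ n) φ (qq p k r) = φ (qq p k (xE p k 1 ^ n * r)) := by
  induction n generalizing r with
  | zero => simp
  | succ n ih => rw [pow_succ', Module.End.mul_apply, opX_apply, ih, pow_succ, mul_assoc]

lemma opY_pow (n : ℕ) (φ : MM p k →ₗ[k] k) (r : MonoidAlgebra k (ElemAbelian p)) :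
    (opY p k ^ n) φ (qq p k r) = φ (qq p k (yE p k 1 ^ n * r)) := by
  induction n generalizing r with
  | zero => simp
  | succ n ih => rw [pow_succ', Module.End.mul_apply, opY_apply, ih, pow_succ, mul_assoc]

lemma qq_YY (r : MonoidAlgebra k (ElemAbelian p)) : qq p k (r * yE p k 1 ^ 2) = 0 :=
  (qq_eq_zero p k).2 (Ideal.mul_mem_left _ _ (Ideal.subset_span (Or.inl rfl)))

lemma qq_XY (r : MonoidAlgebra k (ElemAbelian p)) : qq p k (r * (xE p k 1 * yE p k 1)) = 0 :=
  (qq_eq_zero p k).2 (Ideal.mul_mem_left _ _ (Ideal.subset_span (Or.inr rfl)))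

lemma qq_mon {i j : ℕ} (hj : j ≠ 0) (h : ¬ (i = 0 ∧ j = 1)) :
    qq p k (xE p k 1 ^ i * yE p k 1 ^ j) = 0 := by
  obtain ⟨j, rfl⟩ := Nat.exists_eq_succ_of_ne_zero hj
  rcases i with _ | i
  · rcases j with _ | j
    · simp at h
    · have := qq_YY p k (yE p k 1 ^ j)
      rw [← this]; congr 1; simp only [Nat.succ_eq_add_one]; ring
  · have := qq_XY p k (xE p k 1 ^ i * yE p k 1 ^ j)
    rw [← this]; congr 1; simp only [Nat.succ_eq_add_one]; ring

variable [CharP k p]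

lemma qq_Xpow {i : ℕ} (hi : p ≤ i) : qq p k (xE p k 1 ^ i) = 0 := by
  rw [pow_eq_zero_of_le hi (xE_pow p k 1), map_zero]

lemma dual_ext {φ ψ : MM p k →ₗ[k] k}
    (h1 : ∀ i, i < p → φ (qq p k (xE p k 1 ^ i)) = ψ (qq p k (xE p k 1 ^ i)))
    (h2 : φ (qq p k (yE p k 1)) = ψ (qq p k (yE p k 1))) : φ = ψ := by
  have : φ ∘ₗ qq p k = ψ ∘ₗ qq p k := by
    refine (coords p k 1 one_ne_zero).ext_lin fun i j hi hj => ?_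
    simp only [LinearMap.comp_apply]
    by_cases hj0 : j = 0
    · subst hj0
      simpa using h1 i hi
    · by_cases h : i = 0 ∧ j = 1
      · obtain ⟨rfl, rfl⟩ := h
        simpa using h2
      · rw [qq_mon p k hj0 h, map_zero, map_zero]
  apply LinearMap.ext
  intro w
  obtain ⟨r, rfl⟩ := qq_surj p k w
  exact LinearMap.congr_fun this r

lemma dual_exists (c : ℕ → k) (γ : k) : ∃ φ : MM p k →ₗ[k] k,
    (∀ i, i < p → φ (qq p k (xE p k 1 ^ i)) = c i) ∧ φ (qq p k (yE p k 1)) = γ := by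
  have hp : 1 < p := (Fact.out : p.Prime).one_lt
  set C := coords p k 1 one_ne_zero with hC
  let L : MonoidAlgebra k (ElemAbelian p) →ₗ[k] k := ∑ i ∈ range p, c i • C.c i 0 + γ • C.c 0 1
  have hL : ∀ r, L r = ∑ i ∈ range p, c i * C.c i 0 r + γ * C.c 0 1 r := by
    intro r
    simp [L, LinearMap.sum_apply]
  have hker : LinearMap.ker (qq p k) ≤ LinearMap.ker L := by
    intro r hr
    rw [LinearMap.mem_ker, qq_eq_zero] at hr
    obtain ⟨a, b, hab⟩ := Ideal.mem_span_pair.1 hr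
    have hr' : r = yE p k 1 * (yE p k 1 * a + xE p k 1 * b) := by
      rw [← hab]
      change a * (yE p k 1) ^ 2 + b * (xE p k 1 * yE p k 1) = _
      ring
    rw [LinearMap.mem_ker, hL, hr', sum_eq_zero, C.c_Y_succ 0 0 (by omega) (by omega), map_add,
      C.c_Y_zero 0 (by omega), C.c_X_zero 0 (by omega)]
    · simp
    · intro i hi
      rw [C.c_Y_zero i (mem_range.1 hi), mul_zero]
  have hwd : ∀ r t, qq p k r = qq p k t → L r = L t := by
    intro r t h
    have h' : r - t ∈ LinearMap.ker (qq p k) := by rw [LinearMap.mem_ker, map_sub, h, sub_self]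
    have := hker h'
    rwa [LinearMap.mem_ker, map_sub, sub_eq_zero] at this
  choose g hg using qq_surj p k
  let φ : MM p k →ₗ[k] k :=
    { toFun := fun w => L (g w)
      map_add' := fun v w => by
        rw [← map_add]; apply hwd; rw [map_add, hg, hg, hg]
      map_smul' := fun a w => by
        rw [RingHom.id_apply, ← map_smul]; apply hwd; rw [map_smul, hg, hg] }
  have hv : ∀ r, φ (qq p k r) = L r := fun r => hwd _ _ (hg _)
  refine ⟨φ, ?_⟩
  constructor
  · intro i hi
    rw [hv, hL, sum_eq_single i]
    · have h1 := C.c_mon i 0 i 0 hi (by omega) hi (by omega)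
      have h2 := C.c_mon 0 1 i 0 (by omega) (by omega) hi (by omega)
      rw [pow_zero, mul_one] at h1 h2
      rw [h1, h2]; simp
    · intro j hj hji
      have h1 := C.c_mon j 0 i 0 (mem_range.1 hj) (by omega) hi (by omega)
      rw [pow_zero, mul_one] at h1
      rw [h1]; simp [hji]
    · intro h; exact absurd (mem_range.2 hi) h
  · rw [hv, hL, sum_eq_zero]
    · have h2 := C.c_mon 0 1 0 1 (by omega) (by omega) (by omega) (by omega)
      rw [pow_zero, one_mul, pow_one] at h2
      rw [h2]; simp
    · intro j hj
      have h1 := C.c_mon j 0 0 1 (mem_range.1 hj) (by omega) (by omega) (by omega)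
      rw [pow_zero, one_mul, pow_one] at h1
      rw [h1]; simp

/-- Coordinates on `M*`. -/
noncomputable def evE : (MM p k →ₗ[k] k) ≃ₗ[k] (Fin p → k) × k :=
  LinearEquiv.ofBijective
    ((LinearMap.pi fun i : Fin p => LinearMap.applyₗ (qq p k (xE p k 1 ^ (i : ℕ)))).prod
      (LinearMap.applyₗ (qq p k (yE p k 1)))) (by
    constructor
    · intro φ ψ h
      refine dual_ext p k (fun i hi => ?_) ?_
      · exact congrFun (congrArg Prod.fst h) ⟨i, hi⟩
      · exact congrArg Prod.snd h
    · rintro ⟨c, γ⟩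
      obtain ⟨φ, h1, h2⟩ := dual_exists p k (fun i => if h : i < p then c ⟨i, h⟩ else 0) γ
      refine ⟨φ, Prod.ext (funext fun i => ?_) h2⟩
      exact (h1 i i.2).trans (dif_pos i.2))

lemma evE_fst (φ : MM p k →ₗ[k] k) (i : Fin p) :
    (evE p k φ).1 i = φ (qq p k (xE p k 1 ^ (i : ℕ))) := rfl

lemma evE_snd (φ : MM p k →ₗ[k] k) : (evE p k φ).2 = φ (qq p k (yE p k 1)) := rfl

instance : FiniteDimensional k (MM p k →ₗ[k] k) := (evE p k).symm.finiteDimensional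

lemma finrank_AA : Module.finrank k (MM p k →ₗ[k] k) = p + 1 := by
  rw [(evE p k).finrank_eq]; simp

lemma opX_coord (φ : MM p k →ₗ[k] k) (i : ℕ) :
    opX p k φ (qq p k (xE p k 1 ^ i)) = φ (qq p k (xE p k 1 ^ (i + 1))) := by
  rw [opX_apply, pow_succ']

lemma opX_Y (φ : MM p k →ₗ[k] k) : opX p k φ (qq p k (yE p k 1)) = 0 := by
  have := qq_XY p k 1
  rw [one_mul] at this
  rw [opX_apply, this, map_zero]

lemma opXp_coord (hp : 1 < p) (φ : MM p k →ₗ[k] k) (i : ℕ) :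
    (opX p k ^ (p - 1)) φ (qq p k (xE p k 1 ^ i)) =
      if i = 0 then φ (qq p k (xE p k 1 ^ (p - 1))) else 0 := by
  rw [opX_pow, ← pow_add]
  split_ifs with h
  · rw [h, add_zero]
  · rw [qq_Xpow p k (by omega), map_zero]

lemma opXp_Y (hp : 1 < p) (φ : MM p k →ₗ[k] k) :
    (opX p k ^ (p - 1)) φ (qq p k (yE p k 1)) = 0 := by
  have := qq_mon p k (i := p - 1) one_ne_zero (by omega)
  rw [pow_one] at this
  rw [opX_pow, this, map_zero]

lemma opY_coord (φ : MM p k →ₗ[k] k) (i : ℕ) :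
    opY p k φ (qq p k (xE p k 1 ^ i)) = if i = 0 then φ (qq p k (yE p k 1)) else 0 := by
  rw [opY_apply]
  split_ifs with h
  · rw [h, pow_zero, mul_one]
  · have := qq_mon p k (i := i) one_ne_zero (by omega)
    rw [pow_one] at this
    rw [mul_comm, this, map_zero]

lemma opY_Y (φ : MM p k →ₗ[k] k) : opY p k φ (qq p k (yE p k 1)) = 0 := by
  have := qq_YY p k 1
  rw [one_mul, pow_two] at this
  rw [opY_apply, this, map_zero]

lemma opYp (hp : 2 < p) : opY p k ^ (p - 1) = 0 := by
  apply LinearMap.ext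
  intro φ
  apply LinearMap.ext
  intro w
  obtain ⟨r, rfl⟩ := qq_surj p k w
  have := qq_YY p k (yE p k 1 ^ (p - 3) * r)
  rw [opY_pow, show yE p k 1 ^ (p - 1) * r = yE p k 1 ^ (p - 3) * r * yE p k 1 ^ 2 by
    rw [show p - 1 = (p - 3) + 2 by omega]; ring, this, map_zero]
  rfl

lemma finrank_kerX (hp : 1 < p) : Module.finrank k (LinearMap.ker (opX p k)) = 2 := by
  let f : LinearMap.ker (opX p k) →ₗ[k] k × k :=
    ((LinearMap.applyₗ (qq p k 1)).prod (LinearMap.applyₗ (qq p k (yE p k 1)))) ∘ₗ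
      (LinearMap.ker (opX p k)).subtype
  have hf : Function.Bijective f := by
    constructor
    · rintro ⟨φ, hφ⟩ ⟨ψ, hψ⟩ h
      apply Subtype.ext
      rw [LinearMap.mem_ker] at hφ hψ
      refine dual_ext p k (fun i hi => ?_) (congrArg Prod.snd h)
      rcases i with _ | i
      · rw [pow_zero]; exact congrArg Prod.fst h
      · dsimp only
        rw [← opX_coord, ← opX_coord, hφ, hψ]
    · rintro ⟨a, b⟩
      obtain ⟨φ, h1, h2⟩ := dual_exists p k (fun i => if i = 0 then a else 0) b
      have h3 := h1 0 (by omega)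
      rw [pow_zero] at h3
      refine ⟨⟨φ, ?_⟩, Prod.ext (h3.trans (if_pos rfl)) h2⟩
      rw [LinearMap.mem_ker]
      refine dual_ext p k (fun i hi => ?_) ?_
      · rw [opX_coord]
        by_cases h : i + 1 < p
        · rw [h1 _ h]; simp
        · rw [qq_Xpow p k (by omega), map_zero]; rfl
      · rw [opX_Y]; rfl
  rw [(LinearEquiv.ofBijective f hf).finrank_eq]
  simp

lemma finrank_kerXY (hp : 1 < p) :
    Module.finrank k (LinearMap.ker (opX p k) ⊓ LinearMap.ker (opY p k) :
      Submodule k (MM p k →ₗ[k] k)) = 1 := by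
  let f : (LinearMap.ker (opX p k) ⊓ LinearMap.ker (opY p k) :
      Submodule k (MM p k →ₗ[k] k)) →ₗ[k] k :=
    (LinearMap.applyₗ (qq p k 1)) ∘ₗ
      (LinearMap.ker (opX p k) ⊓ LinearMap.ker (opY p k)).subtype
  have hf : Function.Bijective f := by
    constructor
    · rintro ⟨φ, hφ, hφ'⟩ ⟨ψ, hψ, hψ'⟩ h
      apply Subtype.ext
      replace hφ : opX p k φ = 0 := hφ
      replace hψ : opX p k ψ = 0 := hψ
      replace hφ' : opY p k φ = 0 := hφ'
      replace hψ' : opY p k ψ = 0 := hψ'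
      refine dual_ext p k (fun i hi => ?_) ?_
      · rcases i with _ | i
        · rw [pow_zero]; exact h
        · dsimp only
          rw [← opX_coord, ← opX_coord, hφ, hψ]
      · have h1 := opY_coord p k φ 0
        have h2 := opY_coord p k ψ 0
        rw [if_pos rfl] at h1 h2
        dsimp only
        rw [← h1, ← h2, hφ', hψ']
    · intro a
      obtain ⟨φ, h1, h2⟩ := dual_exists p k (fun i => if i = 0 then a else 0) 0
      have h3 := h1 0 (by omega)
      rw [pow_zero] at h3
      refine ⟨⟨φ, ?_, ?_⟩, (h3.trans (if_pos rfl))⟩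
      · change opX p k φ = 0
        refine dual_ext p k (fun i hi => ?_) ?_
        · rw [opX_coord]
          by_cases h : i + 1 < p
          · rw [h1 _ h]; simp
          · rw [qq_Xpow p k (by omega), map_zero]; rfl
        · rw [opX_Y]; rfl
      · change opY p k φ = 0
        refine dual_ext p k (fun i hi => ?_) ?_
        · rw [opY_coord, h2]; simp
        · rw [opY_Y]; rfl
  rw [(LinearEquiv.ofBijective f hf).finrank_eq]
  simp

lemma finrank_kerXp (hp : 1 < p) : Module.finrank k (LinearMap.ker (opX p k ^ (p - 1))) = p := by
  let f : (MM p k →ₗ[k] k) →ₗ[k] k := LinearMap.applyₗ (qq p k (xE p k 1 ^ (p - 1)))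
  have hf : ∀ φ, f φ = φ (qq p k (xE p k 1 ^ (p - 1))) := fun φ => rfl
  have hk : LinearMap.ker (opX p k ^ (p - 1)) = LinearMap.ker f := by
    ext φ
    rw [LinearMap.mem_ker, LinearMap.mem_ker, hf]
    constructor
    · intro h
      have h1 := opXp_coord p k hp φ 0
      rw [if_pos rfl] at h1
      rw [← h1, h]; rfl
    · intro h
      refine dual_ext p k (fun i hi => ?_) ?_
      · rw [opXp_coord p k hp, h]; simp
      · rw [opXp_Y p k hp]; rfl
  have hs : LinearMap.range f = ⊤ := by
    rw [LinearMap.range_eq_top]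
    intro a
    obtain ⟨φ, h1, h2⟩ := dual_exists p k (fun _ => a) 0
    exact ⟨φ, h1 _ (by omega)⟩
  have := LinearMap.finrank_range_add_finrank_ker f
  rw [hs, finrank_top, finrank_AA, Module.finrank_self] at this
  rw [hk]
  omega

lemma exists_section (hp : 1 < p) : ∃ s : Module.End k (MM p k →ₗ[k] k),
    ∀ φ, (opX p k ^ (p - 1)) (s φ) = opY p k φ := by
  let i0 : Fin p := ⟨p - 1, by omega⟩
  refine ⟨(evE p k).symm.toLinearMap ∘ₗ LinearMap.inl k (Fin p → k) k ∘ₗ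
    LinearMap.single k (fun _ : Fin p => k) i0 ∘ₗ LinearMap.applyₗ (qq p k (yE p k 1)), ?_⟩
  intro φ
  generalize hψ : ((evE p k).symm.toLinearMap ∘ₗ LinearMap.inl k (Fin p → k) k ∘ₗ
    LinearMap.single k (fun _ : Fin p => k) i0 ∘ₗ LinearMap.applyₗ (qq p k (yE p k 1))) φ = ψ
  have h1 : evE p k ψ = (Pi.single i0 (φ (qq p k (yE p k 1))), 0) := by
    rw [← hψ]
    simp only [LinearMap.comp_apply, LinearEquiv.coe_coe, LinearEquiv.apply_symm_apply]
    rfl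
  have h2 : ψ (qq p k (xE p k 1 ^ (p - 1))) = φ (qq p k (yE p k 1)) := by
    have := evE_fst p k ψ i0
    rw [h1] at this
    simpa [i0] using this.symm
  refine dual_ext p k (fun i hi => ?_) ?_
  · rw [opXp_coord p k hp, opY_coord, h2]
  · rw [opXp_Y p k hp, opY_Y]

theorem main (hp2 : p ≠ 2) (n : ℕ) : Module.finrank k (groupCohomology (AA p k) n) = n + 1 := by
  have hp : 1 < p := (Fact.out : p.Prime).one_lt
  obtain ⟨s, hs⟩ := exists_section p k hp
  have hXX : (AA p k).ρ.asAlgebraHom (xE p k (-1) ^ (p - 1)) = opX p k ^ (p - 1) :=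
    map_pow (AA p k).ρ.asAlgebraHom _ _
  have hYY : (AA p k).ρ.asAlgebraHom (yE p k (-1) ^ (p - 1)) = opY p k ^ (p - 1) :=
    map_pow (AA p k).ρ.asAlgebraHom _ _
  have : FiniteDimensional k (AA p k) :=
    inferInstanceAs (FiniteDimensional k (MM p k →ₗ[k] k))
  refine finrank_of_data (AA p k) (coords p k (-1) (by simp)) hp ?_ ?_ (finrank_AA p k) ?_
    (opX p k ^ (p - 2) * s) s ?_ ?_ (finrank_kerXY p k hp) (finrank_kerX p k hp) ?_ n
  · rw [xE, map_sub, aug_of, map_one, sub_self]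
  · rw [yE, map_sub, aug_of, map_one, sub_self]
  · exact hYY.trans (opYp p k (by omega))
  · intro v
    have h := hs v
    rw [show p - 1 = (p - 2) + 1 by omega, pow_succ'] at h
    exact h
  · intro v
    rw [hXX]; exact hs v
  · rw [hXX]; exact finrank_kerXp p k hp

end concrete

end GenDual

/-- Let `p` be an odd prime, `k` a field of characteristic `p`, and
`G = (ℤ/pℤ) × (ℤ/pℤ)` with generators `x, y`.  Let `M = kG/I` where
`I = ((y-1)², (x-1)(y-1))`, and let `M* = Hom_k(M, k)` be the contragredient
representation.  Then for every `n : ℕ`, the group cohomology `H^n(G, M*)` is an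
`(n+1)`-dimensional `k`-vector space. -/
theorem finrank_groupCohomology_dual_genModule
    (p : ℕ) [Fact p.Prime] (hp : p ≠ 2) (k : Type) [Field k] [CharP k p] (n : ℕ) :
    Module.finrank k
      (groupCohomology (Rep.of (Representation.dual
        (Representation.ofModule (k := k) (G := ElemAbelian p) (genModule p k)))) n)
      = n + 1 := by
  exact GenDual.main p k hp n
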